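/- arXiv:0811.0557 — 3 statements merged into one kernel-verified Lean document; each statement's English description precedes it below -/
import Mathlib

section
/- Let ε > 0 and let a, c be real numbers with a > 2 and c > 2. Then I(a,ε,c) = (1/(ε(ε+1))) [ (a−1)(a−2) I(a−2, ε+2, c) + 2(a−1)(c−1) I(a−1, ε+2, c−1) + (c−1)(c−2) I(a, ε+2, c−2) ]. -/
open Real MeasureTheory

/-- Hurwitz zeta as a real-valued function of real arguments. -/
noncomputable def hzeta (z q : ℝ) : ℝ := (HurwitzZeta.hurwitzZeta (q : UnitAddCircle) (z : ℂ)).re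

/-- `I(a,b,c) = ∫₀¹ ζ(1-a,q) ζ(1-b,q) ζ(1-c,q) dq`. -/
noncomputable def Iint (a b c : ℝ) : ℝ :=
  ∫ q in (0:ℝ)..1, hzeta (1 - a) q * hzeta (1 - b) q * hzeta (1 - c) q

/-- `J(a,b,c) = ∫₀¹ ζ(1-a,q) ζ(1-b,q) ζ(1-c,1-q) dq`. -/
noncomputable def Jint (a b c : ℝ) : ℝ :=
  ∫ q in (0:ℝ)..1, hzeta (1 - a) q * hzeta (1 - b) q * hzeta (1 - c) (1 - q)


open HurwitzZeta Set Filter Topology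

/-- The increments of `n ↦ n ^ (-s)`, used as Abel summation weights. -/
noncomputable def cpowDiff (s : ℂ) (n : ℕ) : ℂ :=
  ((n : ℂ) + 2) ^ (-s) - ((n : ℂ) + 1) ^ (-s)

/-- The additive character `q ↦ exp (2πiq)`. -/
noncomputable def expChar (q : ℝ) : ℂ := Complex.exp (2 * π * Complex.I * q)

theorem norm_expChar (q : ℝ) : ‖expChar q‖ = 1 := by
  rw [expChar, show (2 * π * Complex.I * q : ℂ) = ((2 * π * q : ℝ) : ℂ) * Complex.I by
    push_cast; ring]
  exact Complex.norm_exp_ofReal_mul_I _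

theorem continuous_expChar : Continuous expChar := by
  unfold expChar; fun_prop

theorem hasDerivAt_expChar (q : ℝ) :
    HasDerivAt expChar (2 * π * Complex.I * expChar q) q := by
  have h : HasDerivAt (fun x : ℝ => (2 * π * Complex.I * x : ℂ)) (2 * π * Complex.I) q := by
    simpa using (Complex.ofRealCLM.hasDerivAt (x := q)).const_mul (2 * π * Complex.I : ℂ)
  exact h.cexp.congr_deriv (mul_comm _ _)

theorem hasDerivAt_expChar_pow (n : ℕ) (q : ℝ) :
    HasDerivAt (fun x => expChar x ^ n) (2 * π * Complex.I * n * expChar q ^ n) q := by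
  rcases n with _ | n
  · simpa using hasDerivAt_const q (1 : ℂ)
  · refine ((hasDerivAt_expChar q).pow (n + 1)).congr_deriv ?_
    push_cast [Nat.add_sub_cancel]
    ring

theorem expChar_ne_one {q : ℝ} (hq : (q : UnitAddCircle) ≠ 0) : expChar q ≠ 1 := by
  intro h
  obtain ⟨n, hn⟩ := Complex.exp_eq_one_iff.1 h
  apply hq
  rw [AddCircle.coe_eq_zero_iff]
  refine ⟨n, ?_⟩
  have h2 : (2 * π * Complex.I : ℂ) ≠ 0 := Complex.two_pi_I_ne_zero
  have : (q : ℂ) = n := mul_left_cancel₀ h2 (by rw [hn]; ring)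
  have : q = n := by exact_mod_cast this
  simp [this]

theorem norm_cpowDiff_le {s : ℂ} (hs : 0 < s.re) (n : ℕ) :
    ‖cpowDiff s n‖ ≤ ‖s‖ * ((n : ℝ) + 1) ^ (-s.re - 1) := by
  have hs0 : -s ≠ 0 := by
    rintro h
    simp [neg_eq_zero.1 h] at hs
  have hpos : (0 : ℝ) < n + 1 := by positivity
  have key := norm_image_sub_le_of_norm_deriv_le_segment'
    (f := fun x : ℝ => (x : ℂ) ^ (-s)) (f' := fun x : ℝ => -s * (x : ℂ) ^ (-s - 1))
    (C := ‖s‖ * ((n : ℝ) + 1) ^ (-s.re - 1)) (a := (n : ℝ) + 1) (b := (n : ℝ) + 2)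
    (fun x hx => (hasDerivAt_ofReal_cpow_const (by linarith [hx.1]) hs0).hasDerivWithinAt)
    (fun x hx => by
      have hx0 : 0 < x := by linarith [hx.1]
      rw [norm_mul, norm_neg, Complex.norm_cpow_eq_rpow_re_of_pos hx0]
      gcongr
      simpa using Real.rpow_le_rpow_of_nonpos hpos hx.1 (by linarith : -s.re - 1 ≤ 0))
    ((n : ℝ) + 2) ⟨by linarith, le_rfl⟩
  have e : ((n : ℝ) + 2 - (n + 1)) = 1 := by ring
  rw [e, mul_one] at key
  simpa [cpowDiff] using key

theorem summable_add_one_rpow {p : ℝ} (hp : p < -1) :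
    Summable fun n : ℕ => ((n : ℝ) + 1) ^ p := by
  simpa using (summable_nat_add_iff 1).2 (Real.summable_nat_rpow.2 hp)

theorem summable_rpow_mul_norm_cpowDiff {b k : ℝ} (hb : 0 < b) (hk : 0 ≤ k) (hkb : k < b) :
    Summable fun n : ℕ => ((n : ℝ) + 2) ^ k * ‖cpowDiff b n‖ := by
  refine Summable.of_nonneg_of_le (fun n => by positivity) (fun n => ?_)
    ((summable_add_one_rpow (p := k - b - 1) (by linarith)).mul_left (2 ^ k * b))
  have h1 := norm_cpowDiff_le (s := b) (by simpa using hb) n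
  rw [Complex.norm_real, Real.norm_of_nonneg hb.le, Complex.ofReal_re] at h1
  have h2 : ((n : ℝ) + 2) ^ k ≤ 2 ^ k * ((n : ℝ) + 1) ^ k := by
    rw [← Real.mul_rpow (by positivity) (by positivity)]
    exact Real.rpow_le_rpow (by positivity) (by linarith [n.cast_nonneg (α := ℝ)]) hk
  calc _ ≤ (2 ^ k * ((n : ℝ) + 1) ^ k) * (b * ((n : ℝ) + 1) ^ (-b - 1)) := by gcongr
    _ = _ := by
      rw [show k - b - 1 = k + (-b - 1) by ring, Real.rpow_add (by positivity)]
      ring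

theorem summable_cpowDiff {b : ℝ} (hb : 0 < b) : Summable (cpowDiff b) :=
  Summable.of_norm (by simpa using summable_rpow_mul_norm_cpowDiff hb le_rfl hb)

theorem tsum_cpowDiff {b : ℝ} (hb : 0 < b) : ∑' n, cpowDiff b n = -1 := by
  have h1 := (summable_cpowDiff hb).hasSum.tendsto_sum_nat
  have h2 : ∀ N : ℕ, ∑ n ∈ Finset.range N, cpowDiff b n = ((N : ℂ) + 1) ^ (-b : ℂ) - 1 := by
    intro N
    have := Finset.sum_range_sub (fun n : ℕ => ((n : ℂ) + 1) ^ (-b : ℂ)) N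
    simp only [Nat.cast_add, Nat.cast_one, Nat.cast_zero, zero_add, Complex.one_cpow] at this
    rw [← this]
    refine Finset.sum_congr rfl fun n _ => ?_
    rw [cpowDiff, add_assoc, one_add_one_eq_two]
  simp_rw [h2] at h1
  refine tendsto_nhds_unique h1 ?_
  have h3 : Tendsto (fun N : ℕ => ((N : ℂ) + 1) ^ (-b : ℂ)) atTop (𝓝 0) := by
    rw [tendsto_zero_iff_norm_tendsto_zero]
    have : Tendsto (fun N : ℕ => ((N : ℝ) + 1) ^ (-b)) atTop (𝓝 0) :=
      (tendsto_rpow_neg_atTop hb).comp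
        (tendsto_atTop_add_const_right _ _ tendsto_natCast_atTop_atTop)
    refine this.congr fun N => ?_
    have := Complex.norm_cpow_eq_rpow_re_of_pos (x := (N : ℝ) + 1) (by positivity) (-b : ℂ)
    simpa using this.symm
  simpa using h3.sub_const 1

theorem hasSum_expZeta_add_one (q : ℝ) {s : ℂ} (hs : 1 < s.re) :
    HasSum (fun n : ℕ => expChar q ^ (n + 1) * ((n : ℂ) + 1) ^ (-s)) (expZeta q s) := by
  have h := (hasSum_nat_add_iff' 1).2 (hasSum_expZeta_of_one_lt_re q hs)
  have hs0 : s ≠ 0 := by rintro rfl; simp at hs; linarith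
  simp only [Finset.range_one, Finset.sum_singleton, Nat.cast_zero, Complex.zero_cpow hs0,
    div_zero, sub_zero] at h
  refine h.congr_fun fun n => ?_
  rw [expChar, ← Complex.exp_nat_mul, Complex.cpow_neg, div_eq_mul_inv]
  push_cast
  congr 2
  ring

theorem expZeta_abel_of_one_lt_re (q : ℝ) {s : ℂ} (hs : 1 < s.re) :
    (1 - expChar q) * expZeta q s =
      expChar q + ∑' n : ℕ, expChar q ^ (n + 2) * cpowDiff s n := by
  have h := hasSum_expZeta_add_one q hs
  have h1 := (hasSum_nat_add_iff' 1).2 h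
  have h2 := h1.sub (h.mul_left (expChar q))
  have h3 := (h2.congr_fun (g := fun n : ℕ => expChar q ^ (n + 2) * cpowDiff s n) fun n => by
    rw [cpowDiff]
    push_cast
    rw [add_assoc (n : ℂ), one_add_one_eq_two]
    ring).tsum_eq
  rw [h3]
  simp
  ring

theorem expZeta_abel {q : ℝ} (hq : (q : UnitAddCircle) ≠ 0) {s : ℂ} (hs : 0 < s.re) :
    (1 - expChar q) * expZeta q s =
      expChar q + ∑' n : ℕ, expChar q ^ (n + 2) * cpowDiff s n := by
  have hU : IsOpen {z : ℂ | 0 < z.re} := isOpen_lt continuous_const Complex.continuous_re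
  have hd : DifferentiableOn ℂ
      (fun z => ∑' n : ℕ, expChar q ^ (n + 2) * cpowDiff z n) {z : ℂ | 0 < z.re} := by
    intro w hw
    have hw : 0 < w.re := hw
    set V : Set ℂ := {z : ℂ | w.re / 2 < z.re} ∩ Metric.ball 0 (‖w‖ + 1)
    have hV : IsOpen V :=
      (isOpen_lt continuous_const Complex.continuous_re).inter Metric.isOpen_ball
    have hwV : w ∈ V := ⟨by simp only [mem_ofPred_eq]; linarith, by simp⟩
    refine DifferentiableAt.differentiableWithinAt ?_
    refine DifferentiableOn.differentiableAt (s := V) ?_ (hV.mem_nhds hwV)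
    refine Complex.differentiableOn_tsum_of_summable_norm
      (u := fun n : ℕ => (‖w‖ + 1) * ((n : ℝ) + 1) ^ (-(w.re / 2) - 1))
      ((summable_add_one_rpow (by linarith)).mul_left _) (fun n => ?_) hV (fun n z hz => ?_)
    · have h1 : (n : ℂ) + 1 ≠ 0 := by exact_mod_cast n.succ_ne_zero
      have h2 : (n : ℂ) + 2 ≠ 0 := by exact_mod_cast (n + 1).succ_ne_zero
      have : Differentiable ℂ fun z : ℂ => expChar q ^ (n + 2) * cpowDiff z n := by
        unfold cpowDiff
        exact (((differentiable_id.neg).const_cpow (Or.inl h2)).sub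
          ((differentiable_id.neg).const_cpow (Or.inl h1))).const_mul _
      exact this.differentiableOn
    · have hz1 : w.re / 2 < z.re := hz.1
      have hz2 : ‖z‖ < ‖w‖ + 1 := by simpa using hz.2
      rw [norm_mul, norm_pow, norm_expChar, one_pow, one_mul]
      refine (norm_cpowDiff_le (by linarith) n).trans ?_
      gcongr
      linarith [n.cast_nonneg (α := ℝ)]
  have hL : AnalyticOnNhd ℂ (fun z => (1 - expChar q) * expZeta q z) {z : ℂ | 0 < z.re} :=
    (((differentiable_expZeta_of_ne_zero hq).const_mul _).differentiableOn).analyticOnNhd hU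
  have hR := ((differentiableOn_const (expChar q)).add hd).analyticOnNhd hU
  have hconn : IsPreconnected {z : ℂ | 0 < z.re} := (convex_halfSpace_re_gt 0).isPreconnected
  refine hL.eqOn_of_preconnected_of_eventuallyEq hR hconn (z₀ := 2) (by simp) ?_ hs
  have : {z : ℂ | 1 < z.re} ∈ 𝓝 (2 : ℂ) :=
    (isOpen_lt continuous_const Complex.continuous_re).mem_nhds (by simp)
  filter_upwards [this] with z hz using expZeta_abel_of_one_lt_re q hz

theorem hasDerivAt_expZeta {b : ℝ} (hb : 0 < b) {q : ℝ} (hq : (q : UnitAddCircle) ≠ 0) :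
    HasDerivAt (fun x : ℝ => expZeta x (b + 1 : ℝ)) (2 * π * Complex.I * expZeta q b) q := by
  have hb1 : 0 < b + 1 := by linarith
  set S : ℝ → ℂ := fun x => ∑' n : ℕ, expChar x ^ (n + 2) * cpowDiff (b + 1 : ℝ) n
  have hterm (n : ℕ) : ((n : ℂ) + 2) * cpowDiff (b + 1 : ℝ) n =
      cpowDiff b n - ((n : ℂ) + 1) ^ (-(b + 1 : ℝ) : ℂ) := by
    have h1 : (n : ℂ) + 1 ≠ 0 := by exact_mod_cast n.succ_ne_zero
    have h2 : (n : ℂ) + 2 ≠ 0 := by exact_mod_cast (n + 1).succ_ne_zero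
    have e : (-b : ℂ) = -(b + 1 : ℝ) + 1 := by push_cast; ring
    rw [cpowDiff, cpowDiff, e, Complex.cpow_add _ _ h1, Complex.cpow_add _ _ h2,
      Complex.cpow_one, Complex.cpow_one]
    ring
  have hS : HasDerivAt S
      (∑' n : ℕ, 2 * π * Complex.I * (((n : ℂ) + 2) * (expChar q ^ (n + 2) *
        cpowDiff (b + 1 : ℝ) n))) q := by
    refine hasDerivAt_tsum (y₀ := q)
      (g := fun n x => expChar x ^ (n + 2) * cpowDiff (b + 1 : ℝ) n)
      (g' := fun n x => 2 * π * Complex.I * (((n : ℂ) + 2) * (expChar x ^ (n + 2) *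
        cpowDiff (b + 1 : ℝ) n)))
      ((summable_rpow_mul_norm_cpowDiff hb1 zero_le_one (by linarith)).mul_left (2 * π))
      (fun n y => ?_) (fun n y => ?_) ?_ q
    · refine ((hasDerivAt_expChar_pow (n + 2) y).mul_const _).congr_deriv ?_
      push_cast
      ring
    · have : ‖(n : ℂ) + 2‖ = (n : ℝ) + 2 := by exact_mod_cast Complex.norm_natCast (n + 2)
      simp only [norm_mul, norm_pow, norm_expChar, this, Real.rpow_one]
      simp [abs_of_pos Real.pi_pos]
    · refine Summable.of_norm ?_
      simpa [norm_expChar] using (summable_cpowDiff hb1).norm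
  have hS' : ∑' n : ℕ, 2 * π * Complex.I * (((n : ℂ) + 2) * (expChar q ^ (n + 2) *
        cpowDiff (b + 1 : ℝ) n)) = 2 * π * Complex.I *
      (∑' n : ℕ, expChar q ^ (n + 2) * cpowDiff b n - expChar q * expZeta q (b + 1 : ℝ)) := by
    rw [tsum_mul_left]
    congr 1
    have h1 : Summable fun n : ℕ => expChar q ^ (n + 2) * cpowDiff b n :=
      Summable.of_norm (by simpa [norm_expChar] using (summable_cpowDiff hb).norm)
    have h2 := (hasSum_expZeta_add_one q (s := (b + 1 : ℝ)) (by simpa using hb)).mul_left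
      (expChar q)
    rw [← (h1.hasSum.sub h2).tsum_eq]
    refine tsum_congr fun n => ?_
    rw [mul_left_comm, hterm]
    ring
  have hne : 1 - expChar q ≠ 0 := sub_ne_zero.2 (expChar_ne_one hq).symm
  have hev : (fun x : ℝ => expZeta x (b + 1 : ℝ)) =ᶠ[𝓝 q]
      fun x => (expChar x + S x) / (1 - expChar x) := by
    have : ∀ᶠ x : ℝ in 𝓝 q, (x : UnitAddCircle) ≠ 0 :=
      (AddCircle.continuous_mk' (1 : ℝ)).continuousAt.eventually_ne hq
    filter_upwards [this] with x hx
    rw [eq_div_iff (sub_ne_zero.2 (expChar_ne_one hx).symm), mul_comm]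
    exact expZeta_abel hx (by simpa using hb1)
  refine HasDerivAt.congr_of_eventuallyEq ?_ hev
  refine (((hasDerivAt_expChar q).fun_add hS).fun_div ((hasDerivAt_expChar q).const_sub 1)
    hne).congr_deriv ?_
  rw [hS']
  have a1 := expZeta_abel hq (s := b) (by simpa using hb)
  have a2 : (1 - expChar q) * expZeta q (b + 1 : ℝ) = expChar q + S q :=
    expZeta_abel hq (by simpa using hb1)
  rw [← a2, eq_sub_of_add_eq' a1.symm]
  field_simp
  ring

theorem norm_pow_sub_one_le {z : ℂ} (hz : ‖z‖ = 1) {θ : ℝ} (hθ : 0 ≤ θ) (hθ1 : θ ≤ 1) {m : ℕ}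
    (hm : m ≠ 0) : ‖z ^ m - 1‖ ≤ 2 * (m : ℝ) ^ θ * ‖z - 1‖ ^ θ := by
  have h2 : ‖z ^ m - 1‖ ≤ 2 := by
    refine (norm_sub_le _ _).trans ?_
    simp [hz]; norm_num
  have h1 : ‖z ^ m - 1‖ ≤ m * ‖z - 1‖ := by
    rw [← geom_sum_mul, norm_mul]
    gcongr
    refine (norm_sum_le _ _).trans ?_
    simp [hz]
  rw [mul_assoc, ← Real.mul_rpow (by positivity) (by positivity)]
  set x := (m : ℝ) * ‖z - 1‖
  have hx : 0 ≤ x := by positivity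
  rcases le_total x 1 with h | h
  · have := Real.rpow_le_rpow_of_exponent_ge' hx h hθ hθ1
    rw [Real.rpow_one] at this
    linarith
  · linarith [Real.one_le_rpow h hθ]

theorem exists_norm_expZeta_le {b θ : ℝ} (hθ : 0 ≤ θ) (hθ1 : θ ≤ 1) (hθb : θ < b) :
    ∃ C, ∀ q : ℝ, (q : UnitAddCircle) ≠ 0 → ‖expZeta q b‖ ≤ C * ‖expChar q - 1‖ ^ (θ - 1) := by
  have hb : 0 < b := hθ.trans_lt hθb
  have hsum := summable_rpow_mul_norm_cpowDiff hb hθ hθb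
  refine ⟨2 + 2 * ∑' n : ℕ, ((n : ℝ) + 2) ^ θ * ‖cpowDiff b n‖, fun q hq => ?_⟩
  have hne : expChar q - 1 ≠ 0 := sub_ne_zero.2 (expChar_ne_one hq)
  have hpos : 0 < ‖expChar q - 1‖ := norm_pos_iff.2 hne
  have hs1 : Summable fun n : ℕ => expChar q ^ (n + 2) * cpowDiff b n :=
    Summable.of_norm (by simpa [norm_expChar] using (summable_cpowDiff hb).norm)
  have key : (1 - expChar q) * expZeta q b =
      (expChar q - 1) + ∑' n : ℕ, (expChar q ^ (n + 2) - 1) * cpowDiff b n := by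
    simp_rw [sub_mul, one_mul]
    rw [hs1.tsum_sub (summable_cpowDiff hb), tsum_cpowDiff hb]
    have := expZeta_abel hq (s := b) (by simpa using hb)
    rw [sub_mul, one_mul] at this
    rw [this]
    ring
  have hterm (n : ℕ) : ‖(expChar q ^ (n + 2) - 1) * cpowDiff b n‖ ≤
      (2 * ‖expChar q - 1‖ ^ θ) * (((n : ℝ) + 2) ^ θ * ‖cpowDiff b n‖) := by
    have := norm_pow_sub_one_le (norm_expChar q) hθ hθ1 (m := n + 2) (by omega)
    push_cast at this
    rw [norm_mul]
    calc _ ≤ (2 * ((n : ℝ) + 2) ^ θ * ‖expChar q - 1‖ ^ θ) * ‖cpowDiff b n‖ := by gcongr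
      _ = _ := by ring
  have hbd := tsum_of_norm_bounded (hsum.mul_left (2 * ‖expChar q - 1‖ ^ θ)).hasSum hterm
  rw [tsum_mul_left] at hbd
  have h1 : ‖expChar q - 1‖ ≤ 2 * ‖expChar q - 1‖ ^ θ := by
    simpa using norm_pow_sub_one_le (norm_expChar q) hθ hθ1 one_ne_zero
  have h2 : ‖expChar q - 1‖ * ‖expZeta q b‖ ≤ (2 + 2 * ∑' n : ℕ, ((n : ℝ) + 2) ^ θ *
      ‖cpowDiff b n‖) * ‖expChar q - 1‖ ^ θ := by
    rw [← norm_neg (expChar q - 1), neg_sub, ← norm_mul, key, norm_sub_rev 1]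
    refine (norm_add_le _ _).trans ?_
    linarith
  rw [Real.rpow_sub_one hpos.ne', ← mul_div_assoc, le_div_iff₀ hpos]
  linarith

theorem norm_expChar_sub_one (q : ℝ) : ‖expChar q - 1‖ = 2 * |Real.sin (π * q)| := by
  have := Complex.norm_exp_I_mul_ofReal_sub_one (2 * π * q)
  rw [expChar, show (2 * π * Complex.I * q : ℂ) = Complex.I * (2 * π * q : ℝ) by push_cast; ring,
    this]
  simp
  ring_nf

theorem norm_expChar_sub_one_rpow_le {p : ℝ} (hp : p ≤ 0) {q : ℝ} (hq : q ∈ Ioo (0 : ℝ) 1) :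
    ‖expChar q - 1‖ ^ p ≤ q ^ p + (1 - q) ^ p := by
  obtain ⟨h0, h1⟩ := hq
  have h1' : 0 < 1 - q := by linarith
  have sin_ge {x : ℝ} (hx : 0 < x) (hx2 : x ≤ 1 / 2) : x ≤ 2 * |Real.sin (π * x)| := by
    have := Real.mul_le_sin (x := π * x) (by positivity) (by nlinarith [Real.pi_pos])
    have e : 2 / π * (π * x) = 2 * x := by field_simp
    linarith [le_abs_self (Real.sin (π * x))]
  have p1 : 0 ≤ q ^ p := by positivity
  have p2 : 0 ≤ (1 - q) ^ p := by positivity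
  rw [norm_expChar_sub_one]
  rcases le_total q (1 / 2) with h | h
  · linarith [Real.rpow_le_rpow_of_nonpos h0 (sin_ge h0 h) hp]
  · have := sin_ge h1' (by linarith)
    rw [mul_sub, mul_one, Real.sin_pi_sub] at this
    linarith [Real.rpow_le_rpow_of_nonpos h1' this hp]

theorem continuous_expZeta {b : ℝ} (hb : 1 < b) : Continuous fun q : ℝ => expZeta q b := by
  have h (q : ℝ) := (hasSum_expZeta_add_one q (s := b) (by simpa using hb)).tsum_eq
  simp_rw [← h]
  refine continuous_tsum (fun n => (continuous_expChar.pow _).mul continuous_const)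
    (summable_add_one_rpow (p := -b) (by linarith)) (fun n q => ?_)
  have := Complex.norm_cpow_eq_rpow_re_of_pos (x := (n : ℝ) + 1) (by positivity) (-b : ℂ)
  simp only [Complex.ofReal_add, Complex.ofReal_natCast, Complex.ofReal_one, Complex.neg_re,
    Complex.ofReal_re] at this
  rw [norm_mul, norm_pow, norm_expChar, one_pow, one_mul, this]

/-- The right-hand side of Hurwitz's formula for `ζ(1 - b, q)`. -/
noncomputable def hurwitzFormula (b q : ℝ) : ℂ :=
  (2 * π : ℂ) ^ (-b : ℂ) * Complex.Gamma b *
    (Complex.exp (-π * Complex.I * b / 2) * expZeta q b +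
      Complex.exp (π * Complex.I * b / 2) * expZeta (-q : ℝ) b)

theorem hzeta_one_sub {b q : ℝ} (hb : 0 < b) (h : (q : UnitAddCircle) ≠ 0 ∨ b ≠ 1) :
    hzeta (1 - b) q = (hurwitzFormula b q).re := by
  have := hurwitzZeta_one_sub (q : UnitAddCircle) (s := b)
    (fun n hn => by
      have : b = -n := by exact_mod_cast hn
      linarith [n.cast_nonneg (α := ℝ)])
    (h.imp_right fun h => by exact_mod_cast h)
  rw [hzeta, hurwitzFormula, AddCircle.coe_neg, ← this]
  push_cast
  rfl

theorem continuous_hzeta {b : ℝ} (hb : 1 < b) : Continuous (hzeta (1 - b)) := by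
  have h : hzeta (1 - b) = fun q => (hurwitzFormula b q).re :=
    funext fun q => hzeta_one_sub (by linarith) (Or.inr hb.ne')
  rw [h]
  refine Complex.continuous_re.comp (continuous_const.mul (.add ?_ ?_))
  · exact continuous_const.mul (continuous_expZeta hb)
  · exact continuous_const.mul ((continuous_expZeta hb).comp continuous_neg)

theorem coe_ne_zero_of_mem_Ioo {q : ℝ} (hq : q ∈ Ioo (0 : ℝ) 1) : (q : UnitAddCircle) ≠ 0 := by
  rw [Ne, AddCircle.coe_eq_zero_iff_of_mem_Ico ⟨hq.1.le, hq.2⟩]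
  exact hq.1.ne'

theorem hasDerivAt_hurwitzFormula {b : ℝ} (hb : 0 < b) {q : ℝ} (hq : (q : UnitAddCircle) ≠ 0) :
    HasDerivAt (hurwitzFormula (b + 1)) (b * hurwitzFormula b q) q := by
  have hq' : ((-q : ℝ) : UnitAddCircle) ≠ 0 := by rwa [AddCircle.coe_neg, neg_ne_zero]
  have h1 := hasDerivAt_expZeta hb hq
  have h2 := (hasDerivAt_expZeta hb hq').scomp q (hasDerivAt_neg q)
  refine (((h1.const_mul (Complex.exp (-π * Complex.I * (b + 1 : ℝ) / 2))).add
    (h2.const_mul (Complex.exp (π * Complex.I * (b + 1 : ℝ) / 2)))).const_mul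
    ((2 * π : ℂ) ^ (-(b + 1 : ℝ) : ℂ) * Complex.Gamma (b + 1 : ℝ))).congr_deriv ?_
  have hb0 : (b : ℂ) ≠ 0 := by exact_mod_cast hb.ne'
  have hpi : (2 * π : ℂ) ≠ 0 := by exact_mod_cast Real.two_pi_pos.ne'
  have e1 : Complex.exp (-π * Complex.I * (b + 1 : ℝ) / 2) =
      Complex.exp (-π * Complex.I * b / 2) * -Complex.I := by
    rw [← Complex.exp_neg_pi_div_two_mul_I, ← Complex.exp_add]
    push_cast
    congr 1
    ring
  have e2 : Complex.exp (π * Complex.I * (b + 1 : ℝ) / 2) =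
      Complex.exp (π * Complex.I * b / 2) * Complex.I := by
    nth_rw 3 [← Complex.exp_pi_div_two_mul_I]
    rw [← Complex.exp_add]
    push_cast
    congr 1
    ring
  have e3 : (2 * π : ℂ) ^ (-(b + 1 : ℝ) : ℂ) = (2 * π : ℂ) ^ (-b : ℂ) / (2 * π) := by
    rw [show (-(b + 1 : ℝ) : ℂ) = -b - 1 by push_cast; ring, Complex.cpow_sub _ _ hpi,
      Complex.cpow_one]
  have e4 : Complex.Gamma (b + 1 : ℝ) = b * Complex.Gamma b := by
    push_cast
    exact Complex.Gamma_add_one _ hb0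
  rw [e1, e2, e3, e4, hurwitzFormula]
  have hpi' : (π : ℂ) ≠ 0 := by exact_mod_cast Real.pi_ne_zero
  simp only [neg_smul, one_smul]
  field_simp
  rw [Complex.I_sq]
  ring

theorem hasDerivAt_hzeta {b : ℝ} (hb : 0 < b) {q : ℝ} (hq : q ∈ Ioo (0 : ℝ) 1) :
    HasDerivAt (hzeta (1 - (b + 1))) (b * hzeta (1 - b) q) q := by
  have hq0 := coe_ne_zero_of_mem_Ioo hq
  have hf : hzeta (1 - (b + 1)) = fun x => (hurwitzFormula (b + 1) x).re :=
    funext fun x => hzeta_one_sub (by linarith) (Or.inr (by linarith))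
  rw [hf, hzeta_one_sub hb (Or.inl hq0)]
  have := Complex.reCLM.hasFDerivAt.comp_hasDerivAt q (hasDerivAt_hurwitzFormula hb hq0)
  refine this.congr_deriv ?_
  simp

theorem intervalIntegrable_hzeta {b : ℝ} (hb : 0 < b) :
    IntervalIntegrable (hzeta (1 - b)) volume 0 1 := by
  set θ := min b 1 / 2 with hθ
  have hm : 0 < min b 1 := lt_min hb one_pos
  have hmb := min_le_left b 1
  have hm1 := min_le_right b 1
  obtain ⟨C, hC⟩ := exists_norm_expZeta_le (b := b) (θ := θ) (by linarith) (by linarith)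
    (by linarith)
  set K := ‖(2 * π : ℂ) ^ (-b : ℂ) * Complex.Gamma b‖ *
    ((‖Complex.exp (-π * Complex.I * b / 2)‖ + ‖Complex.exp (π * Complex.I * b / 2)‖) * |C|)
  have hdom : IntervalIntegrable (fun q : ℝ => K * (q ^ (θ - 1) + (1 - q) ^ (θ - 1)))
      volume 0 1 := by
    have h1 := intervalIntegral.intervalIntegrable_rpow' (r := θ - 1) (by linarith)
      (a := 0) (b := 1)
    have h2 := (intervalIntegral.intervalIntegrable_rpow' (r := θ - 1) (by linarith)
      (a := 1) (b := 0)).comp_sub_left 1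
    simp only [sub_self, sub_zero] at h2
    exact (h1.add h2).const_mul K
  rw [intervalIntegrable_iff_integrableOn_Ioo_of_le zero_le_one] at hdom ⊢
  refine Integrable.mono' hdom ?_ ?_
  · have : AEStronglyMeasurable (fun q => b⁻¹ * deriv (hzeta (1 - (b + 1))) q)
        (volume.restrict (Ioo (0 : ℝ) 1)) :=
      ((measurable_deriv _).const_mul _).aestronglyMeasurable
    refine this.congr ?_
    filter_upwards [ae_restrict_mem measurableSet_Ioo] with q hq
    rw [(hasDerivAt_hzeta hb hq).deriv, inv_mul_cancel_left₀ hb.ne']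
  · filter_upwards [ae_restrict_mem measurableSet_Ioo] with q hq
    have hq0 := coe_ne_zero_of_mem_Ioo hq
    have hq0' : ((-q : ℝ) : UnitAddCircle) ≠ 0 := by rwa [AddCircle.coe_neg, neg_ne_zero]
    have hr := norm_expChar_sub_one_rpow_le (p := θ - 1) (by linarith) hq
    have hle {x : ℝ} (hx : (x : UnitAddCircle) ≠ 0)
        (hxq : ‖expChar x - 1‖ = ‖expChar q - 1‖) :
        ‖expZeta x b‖ ≤ |C| * (q ^ (θ - 1) + (1 - q) ^ (θ - 1)) := by
      refine (hC x hx).trans ?_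
      rw [hxq]
      gcongr
      exact le_abs_self C
    have b1 := hle hq0 rfl
    have b2 := hle hq0' (by simp [norm_expChar_sub_one])
    rw [hzeta_one_sub hb (Or.inl hq0)]
    refine (Complex.abs_re_le_norm _).trans ?_
    rw [hurwitzFormula, norm_mul]
    calc _ ≤ ‖(2 * π : ℂ) ^ (-b : ℂ) * Complex.Gamma b‖ *
        (‖Complex.exp (-π * Complex.I * b / 2)‖ * (|C| * (q ^ (θ - 1) + (1 - q) ^ (θ - 1))) +
        ‖Complex.exp (π * Complex.I * b / 2)‖ * (|C| * (q ^ (θ - 1) + (1 - q) ^ (θ - 1)))) := by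
          gcongr
          refine (norm_add_le _ _).trans ?_
          rw [norm_mul, norm_mul]
          gcongr
      _ = _ := by ring

theorem hzeta_one_eq_hzeta_zero (z : ℝ) : hzeta z 1 = hzeta z 0 := by
  rw [hzeta, hzeta, AddCircle.coe_period, QuotientAddGroup.mk_zero]

/-- Integration by parts raises the middle index by one. -/
theorem Iint_recursion {a b c : ℝ} (ha : 1 < a) (hb : 0 < b) (hc : 1 < c) :
    b * Iint a b c =
      -((a - 1) * Iint (a - 1) (b + 1) c + (c - 1) * Iint a (b + 1) (c - 1)) := by
  have hda {q : ℝ} (hq : q ∈ Ioo (0 : ℝ) 1) :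
      HasDerivAt (hzeta (1 - a)) ((a - 1) * hzeta (1 - (a - 1)) q) q := by
    simpa using hasDerivAt_hzeta (b := a - 1) (by linarith) hq
  have hdc {q : ℝ} (hq : q ∈ Ioo (0 : ℝ) 1) :
      HasDerivAt (hzeta (1 - c)) ((c - 1) * hzeta (1 - (c - 1)) q) q := by
    simpa using hasDerivAt_hzeta (b := c - 1) (by linarith) hq
  have ca := continuous_hzeta ha
  have cc := continuous_hzeta hc
  have cb := continuous_hzeta (b := b + 1) (by linarith)
  have ia := intervalIntegrable_hzeta (b := a - 1) (by linarith)
  have ic := intervalIntegrable_hzeta (b := c - 1) (by linarith)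
  have iac := (ia.const_mul (a - 1)).mul_continuousOn cc.continuousOn
  have ica := (ic.const_mul (c - 1)).continuousOn_mul ca.continuousOn
  have key := intervalIntegral.integral_mul_deriv_eq_deriv_mul_of_hasDeriv_right
    (a := 0) (b := 1) (u := fun q => hzeta (1 - a) q * hzeta (1 - c) q)
    (v := hzeta (1 - (b + 1))) (v' := fun q => b * hzeta (1 - b) q)
    (ca.mul cc).continuousOn cb.continuousOn
    (fun q hq => by
      rw [min_eq_left zero_le_one, max_eq_right zero_le_one] at hq
      exact ((hda hq).mul (hdc hq)).hasDerivWithinAt)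
    (fun q hq => by
      rw [min_eq_left zero_le_one, max_eq_right zero_le_one] at hq
      exact (hasDerivAt_hzeta hb hq).hasDerivWithinAt)
    (iac.add ica) ((intervalIntegrable_hzeta hb).const_mul b)
  simp only [hzeta_one_eq_hzeta_zero, sub_self, zero_sub, add_mul] at key
  rw [intervalIntegral.integral_add (iac.mul_continuousOn cb.continuousOn)
    (ica.mul_continuousOn cb.continuousOn)] at key
  simp only [Iint, ← intervalIntegral.integral_const_mul]
  convert key using 1
  · congr 1; ext q; ring
  · congr 3 <;> · ext q; ring

theorem I_recursion_twice (ε a c : ℝ) (hε : 0 < ε) (ha : 2 < a) (hc : 2 < c) :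
    Iint a ε c = (1 / (ε * (ε + 1))) *
      ((a - 1) * (a - 2) * Iint (a - 2) (ε + 2) c
        + 2 * (a - 1) * (c - 1) * Iint (a - 1) (ε + 2) (c - 1)
        + (c - 1) * (c - 2) * Iint a (ε + 2) (c - 2)) := by
  have h0 := Iint_recursion (a := a) (b := ε) (c := c) (by linarith) hε (by linarith)
  have h1 := Iint_recursion (a := a - 1) (b := ε + 1) (c := c) (by linarith) (by linarith)
    (by linarith)
  have h2 := Iint_recursion (a := a) (b := ε + 1) (c := c - 1) (by linarith) (by linarith)
    (by linarith)
  rw [show ε + 1 + 1 = ε + 2 by ring] at h1 h2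
  rw [show a - 1 - 1 = a - 2 by ring] at h1
  rw [show c - 1 - 1 = c - 2 by ring] at h2
  have hε1 : ε + 1 ≠ 0 := by linarith
  rw [one_div, eq_inv_mul_iff_mul_eq₀ (mul_ne_zero hε.ne' hε1)]
  linear_combination (ε + 1) * h0 - (a - 1) * h1 - (c - 1) * h2
end

section
/- Let a, c be real numbers with a > 2 and c > 2 which are not positive integers. Then (1−a) I(a−1,c,1) + (1−c) I(a,c−1,1) = ζ(1−a) ζ(1−c) − ∫₀¹ ζ(1−a,q) ζ(1−c,q) dq. -/
open Real MeasureTheory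

/-- Riemann zeta as a real-valued function of a real argument. -/
noncomputable def rzeta (s : ℝ) : ℝ := (riemannZeta (s : ℂ)).re

open HurwitzZeta in
lemma hasDerivAt_expZeta_s12 {s : ℝ} (hs : 2 < s) (q : ℝ) :
    HasDerivAt (fun q : ℝ ↦ expZeta (q : UnitAddCircle) (s : ℂ))
      (2 * π * Complex.I * expZeta (q : UnitAddCircle) ((s - 1 : ℝ) : ℂ)) q := by
  have hs1 : 1 < (s : ℂ).re := by simp; linarith
  have hs2 : 1 < ((s - 1 : ℝ) : ℂ).re := by simp; linarith
  have hterm (n : ℕ) (y : ℝ) :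
      HasDerivAt (fun q : ℝ ↦ Complex.exp (2 * π * Complex.I * q * n) / (n : ℂ) ^ (s : ℂ))
        (2 * π * Complex.I *
          (Complex.exp (2 * π * Complex.I * (y : ℂ) * n) / (n : ℂ) ^ ((s - 1 : ℝ) : ℂ))) y := by
    have h : HasDerivAt (fun q : ℝ ↦ 2 * π * Complex.I * (q : ℂ) * n)
        (2 * π * Complex.I * 1 * n) y :=
      ((Complex.ofRealCLM.hasDerivAt (x := y)).const_mul _).mul_const _
    convert! (h.cexp).div_const ((n : ℂ) ^ (s : ℂ)) using 1
    rcases eq_or_ne n 0 with rfl | hn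
    · simp [Complex.zero_cpow, show (s : ℂ) - 1 ≠ 0 by
        rw [← Complex.ofReal_one, ← Complex.ofReal_sub, Complex.ofReal_ne_zero]; linarith]
    · have hn' : (n : ℂ) ≠ 0 := by exact_mod_cast hn
      rw [Complex.ofReal_sub, Complex.ofReal_one, Complex.cpow_sub _ _ hn', Complex.cpow_one]
      have : (n : ℂ) ^ (s : ℂ) ≠ 0 := by simp [Complex.cpow_eq_zero_iff, hn']
      field_simp
  have hsum : Summable fun n : ℕ ↦ 2 * π * (1 / (n : ℝ) ^ (s - 1)) :=
    (Real.summable_one_div_nat_rpow.mpr (by linarith)).mul_left _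
  convert! hasDerivAt_tsum hsum hterm (fun n y ↦ ?_) (hasSum_expZeta_of_one_lt_re 0 hs1).summable q
    using 1
  · funext y
    exact (hasSum_expZeta_of_one_lt_re y hs1).tsum_eq.symm
  · rw [tsum_mul_left, (hasSum_expZeta_of_one_lt_re q hs2).tsum_eq]
  · rw [norm_mul, norm_div, show 2 * π * Complex.I * (y : ℂ) * n
      = ((2 * π * y * n : ℝ) : ℂ) * Complex.I by push_cast; ring, Complex.norm_exp_ofReal_mul_I,
      Complex.norm_natCast_cpow_of_re_ne_zero _ (by linarith), Complex.ofReal_re]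
    simp [abs_of_pos Real.pi_pos]

open HurwitzZeta in
lemma continuous_expZeta_s12 {s : ℝ} (hs : 1 < s) :
    Continuous (fun q : ℝ ↦ expZeta (q : UnitAddCircle) (s : ℂ)) := by
  have hs1 : 1 < (s : ℂ).re := by simpa
  simp_rw [← fun y : ℝ ↦ (hasSum_expZeta_of_one_lt_re y hs1).tsum_eq]
  refine continuous_tsum (fun n ↦ by fun_prop) (Real.summable_one_div_nat_rpow.mpr hs)
    (fun n y ↦ ?_)
  rw [norm_div, show 2 * π * Complex.I * (y : ℂ) * n
    = ((2 * π * y * n : ℝ) : ℂ) * Complex.I by push_cast; ring, Complex.norm_exp_ofReal_mul_I,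
    Complex.norm_natCast_cpow_of_re_ne_zero _ (by linarith), Complex.ofReal_re]

open HurwitzZeta in
lemma hurwitzZeta_one_sub_ofReal {s : ℝ} (hs : 1 < s) (q : ℝ) :
    hurwitzZeta (q : UnitAddCircle) ((1 - s : ℝ) : ℂ) =
      (2 * π) ^ (-s : ℂ) * Complex.Gamma s *
        (Complex.exp (-π * Complex.I * s / 2) * expZeta (q : UnitAddCircle) s +
          Complex.exp (π * Complex.I * s / 2) * expZeta ((-q : ℝ) : UnitAddCircle) s) := by
  rw [Complex.ofReal_sub, Complex.ofReal_one, hurwitzZeta_one_sub, AddCircle.coe_neg]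
  · intro n h
    have : s = -n := by exact_mod_cast h
    have : (0 : ℝ) ≤ n := n.cast_nonneg
    linarith
  · right
    exact_mod_cast hs.ne'

open HurwitzZeta in
lemma continuous_hzeta_one_sub {s : ℝ} (hs : 1 < s) : Continuous (hzeta (1 - s)) := by
  unfold hzeta
  simp_rw [hurwitzZeta_one_sub_ofReal hs]
  have h := continuous_expZeta_s12 hs
  have h' := h.comp continuous_neg
  exact Complex.continuous_re.comp (continuous_const.mul
    ((continuous_const.mul h).add (continuous_const.mul h')))

open HurwitzZeta in
lemma hasDerivAt_hzeta_one_sub {s : ℝ} (hs : 2 < s) (q : ℝ) :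
    HasDerivAt (hzeta (1 - s)) ((s - 1) * hzeta (1 - (s - 1)) q) q := by
  have h := hasDerivAt_expZeta_s12 hs q
  have h' := (hasDerivAt_expZeta_s12 hs (-q)).scomp q (hasDerivAt_neg q)
  have key := ((h.const_mul (Complex.exp (-π * Complex.I * s / 2))).add
    (h'.const_mul (Complex.exp (π * Complex.I * s / 2)))).const_mul
      ((2 * π) ^ (-s : ℂ) * Complex.Gamma s)
  have key' := Complex.reCLM.hasFDerivAt.comp_hasDerivAt q key
  convert! key' using 1
  · funext y
    simp only [hzeta, hurwitzZeta_one_sub_ofReal (show 1 < s by linarith)]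
    rfl
  · rw [hzeta, hurwitzZeta_one_sub_ofReal (by linarith), ← Complex.re_ofReal_mul,
      Complex.reCLM_apply]
    congr 1
    have hπ : (2 * π : ℂ) ≠ 0 := by simp [Real.pi_ne_zero]
    have hs0 : ((s - 1 : ℝ) : ℂ) ≠ 0 := by
      rw [Complex.ofReal_ne_zero]; linarith
    obtain ⟨t, rfl⟩ : ∃ t, s = t + 1 := ⟨s - 1, by ring⟩
    simp only [add_sub_cancel_right] at hs0 ⊢
    have e1 : Complex.exp (-π * Complex.I * ((t + 1 : ℝ) : ℂ) / 2) =
        -Complex.I * Complex.exp (-π * Complex.I * t / 2) := by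
      rw [← Complex.exp_neg_pi_div_two_mul_I, ← Complex.exp_add]
      push_cast; ring_nf
    have e2 : Complex.exp (π * Complex.I * ((t + 1 : ℝ) : ℂ) / 2) =
        Complex.I * Complex.exp (π * Complex.I * t / 2) := by
      rw [show π * Complex.I * ((t + 1 : ℝ) : ℂ) / 2 = π / 2 * Complex.I + π * Complex.I * t / 2 by
        push_cast; ring, Complex.exp_add, Complex.exp_pi_div_two_mul_I]
    have e3 : Complex.Gamma ((t + 1 : ℝ) : ℂ) = t * Complex.Gamma t := by
      push_cast; exact Complex.Gamma_add_one _ hs0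
    have e4 : (2 * π : ℂ) ^ (-((t + 1 : ℝ) : ℂ)) * (2 * π) = (2 * π) ^ (-(t : ℂ)) := by
      rw [show -(t : ℂ) = -((t + 1 : ℝ) : ℂ) + 1 by push_cast; ring, Complex.cpow_add _ _ hπ,
        Complex.cpow_one]
    rw [e1, e2, e3, ← e4]
    simp only [neg_smul, one_smul]
    linear_combination ((2 * π : ℂ) ^ (-((t + 1 : ℝ) : ℂ)) * (2 * π) * t * Complex.Gamma t *
      (Complex.exp (-π * Complex.I * t / 2) * expZeta (q : UnitAddCircle) t +
          Complex.exp (π * Complex.I * t / 2) * expZeta ((-q : ℝ) : UnitAddCircle) t)) *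
        Complex.I_sq

lemma norm_cpow_neg_sub_le {s : ℂ} (hs : 0 < s.re) {x y : ℝ} (hx : 0 < x) (hxy : x ≤ y) :
    ‖(x : ℂ) ^ (-s) - (y : ℂ) ^ (-s)‖ ≤ ‖s‖ * x ^ (-s.re - 1) * (y - x) := by
  have hs0 : -s ≠ 0 := by
    rintro h
    simp [neg_eq_zero.mp h] at hs
  have h := (convex_Icc x y).norm_image_sub_le_of_norm_hasDerivWithin_le (𝕜 := ℝ)
    (f := fun t : ℝ ↦ (t : ℂ) ^ (-s)) (f' := fun t ↦ -s * (t : ℂ) ^ (-s - 1))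
    (C := ‖s‖ * x ^ (-s.re - 1))
    (fun t ht ↦ (hasDerivAt_ofReal_cpow_const (hx.trans_le ht.1).ne' hs0).hasDerivWithinAt)
    (fun t ht ↦ ?_) (Set.left_mem_Icc.mpr hxy) (Set.right_mem_Icc.mpr hxy)
  · rwa [norm_sub_rev, Real.norm_of_nonneg (sub_nonneg.mpr hxy)] at h
  · rw [norm_mul, norm_neg, Complex.norm_cpow_eq_rpow_re_of_pos (hx.trans_le ht.1)]
    simp only [Complex.sub_re, Complex.neg_re, Complex.one_re]
    gcongr ?_ * ?_
    exact Real.rpow_le_rpow_of_nonpos hx ht.1 (by linarith)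

lemma rpow_neg_sub_mem_Icc {s : ℝ} (hs : 0 < s) {x y : ℝ} (hx : 0 < x) (hxy : x ≤ y) :
    x ^ (-s) - y ^ (-s) ∈
      Set.Icc (s * (y - x) * y ^ (-(s + 1))) (s * (y - x) * x ^ (-(s + 1))) := by
  rcases hxy.eq_or_lt with rfl | hlt
  · simp
  obtain ⟨c, hc, h⟩ := exists_hasDerivAt_eq_slope (fun t : ℝ ↦ t ^ (-s))
    (fun t ↦ -s * t ^ (-s - 1)) hlt
    (fun t ht ↦ (Real.continuousAt_rpow_const _ _
      (Or.inl (hx.trans_le ht.1).ne')).continuousWithinAt)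
    (fun t ht ↦ Real.hasDerivAt_rpow_const (Or.inl (hx.trans ht.1).ne'))
  have hyx : 0 < y - x := sub_pos.mpr hlt
  rw [eq_div_iff hyx.ne', show -s - 1 = -(s + 1) by ring] at h
  have h' : x ^ (-s) - y ^ (-s) = s * (y - x) * c ^ (-(s + 1)) := by linear_combination h
  rw [h']
  have := hx.trans hc.1
  constructor
  · gcongr ?_ * ?_
    exact Real.rpow_le_rpow_of_nonpos this hc.2.le (by linarith)
  · gcongr ?_ * ?_
    exact Real.rpow_le_rpow_of_nonpos hx hc.1.le (by linarith)

lemma summable_nat_add_rpow_neg {q σ : ℝ} (hq : 0 < q) (hσ : 1 < σ) :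
    Summable fun n : ℕ ↦ ((n : ℝ) + q) ^ (-σ) := by
  refine ((Real.summable_one_div_nat_add_rpow q σ).mpr hσ).congr fun n ↦ ?_
  rw [abs_of_nonneg (by positivity), Real.rpow_neg (by positivity), one_div]

open HurwitzZeta Set in
lemma hurwitzZeta_sub_riemannZeta_eq_tsum {q : ℝ} (hq : q ∈ Ioc 0 1) {s : ℂ} (hs : 0 < s.re) :
    hurwitzZeta (q : UnitAddCircle) s - riemannZeta s =
      ∑' n : ℕ, (((n + q : ℝ) : ℂ) ^ (-s) - ((n + 1 : ℝ) : ℂ) ^ (-s)) := by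
  obtain ⟨hq0, hq1⟩ := hq
  set δ : ℝ := min s.re 1 / 2 with hδ
  have hδ0 : 0 < δ := half_pos (lt_min hs one_pos)
  have hδs : δ < s.re := by
    have := min_le_left s.re 1; linarith
  have hδ2 : δ < 2 := by
    have := min_le_right s.re 1; linarith
  set R : ℝ := ‖s‖ + 4
  set U : Set ℂ := {z | δ < z.re} ∩ Metric.ball 0 R
  have hUo : IsOpen U := (isOpen_lt continuous_const Complex.continuous_re).inter Metric.isOpen_ball
  have hUc : Convex ℝ U := (convex_halfSpace_re_gt δ).inter (convex_ball _ _)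
  have hsU : s ∈ U := ⟨hδs, by simp [R]⟩
  have h2U : (2 : ℂ) ∈ U := ⟨by simpa using hδ2, by simp [R]; linarith [norm_nonneg s]⟩
  have hpos (n : ℕ) : 0 < (n : ℝ) + q := by positivity
  have hpos1 (n : ℕ) : 0 < (n : ℝ) + 1 := by positivity
  have hbound : Summable fun n : ℕ ↦ R * (1 + q ^ (-(R + 1))) * ((n : ℝ) + q) ^ (-(δ + 1)) :=
    (summable_nat_add_rpow_neg hq0 (by linarith)).mul_left _
  have hdiff : DifferentiableOn ℂ (fun s : ℂ ↦
      ∑' n : ℕ, (((n + q : ℝ) : ℂ) ^ (-s) - ((n + 1 : ℝ) : ℂ) ^ (-s))) U := by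
    refine Complex.differentiableOn_tsum_of_summable_norm hbound (fun n ↦ ?_) hUo fun n z hz ↦ ?_
    · intro z _
      refine DifferentiableAt.differentiableWithinAt (.sub ?_ ?_)
      · exact differentiableAt_id.neg.const_cpow (Or.inl (Complex.ofReal_ne_zero.mpr (hpos n).ne'))
      · exact differentiableAt_id.neg.const_cpow (Or.inl (Complex.ofReal_ne_zero.mpr (hpos1 n).ne'))
    · have hzre : δ < z.re := hz.1
      have hzR : ‖z‖ < R := by simpa using hz.2
      refine (norm_cpow_neg_sub_le (hδ0.trans hzre) (hpos n) (by linarith)).trans ?_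
      have h1 : ((n : ℝ) + q) ^ (-z.re - 1) ≤
          (1 + q ^ (-(R + 1))) * ((n : ℝ) + q) ^ (-(δ + 1)) := by
        rw [one_add_mul]
        rcases le_total 1 ((n : ℝ) + q) with h | h
        · have := Real.rpow_le_rpow_of_exponent_le h (show -z.re - 1 ≤ -(δ + 1) by linarith)
          have : 0 ≤ q ^ (-(R + 1)) * ((n : ℝ) + q) ^ (-(δ + 1)) := by positivity
          linarith
        · have hre : z.re ≤ R := (Complex.re_le_norm z).trans hzR.le
          have h3 := Real.rpow_le_rpow_of_exponent_ge (hpos n) h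
            (show -(R + 1) ≤ -z.re - 1 by linarith)
          have h4 := Real.rpow_le_rpow_of_nonpos hq0 (show q ≤ n + q by simp)
            (show -(R + 1) ≤ 0 by linarith [norm_nonneg z])
          have h5 := Real.one_le_rpow_of_pos_of_le_one_of_nonpos (hpos n) h
            (show -(δ + 1) ≤ 0 by linarith)
          have h6 : 0 ≤ q ^ (-(R + 1)) := by positivity
          nlinarith
      have hR : 0 ≤ R := by positivity
      calc ‖z‖ * ((n : ℝ) + q) ^ (-z.re - 1) * ((n + 1 : ℝ) - (n + q))
          ≤ R * ((1 + q ^ (-(R + 1))) * ((n : ℝ) + q) ^ (-(δ + 1))) * 1 := by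
            gcongr
            all_goals linarith
        _ = _ := by ring
  have hL : AnalyticOnNhd ℂ
      (fun s ↦ hurwitzZeta (q : UnitAddCircle) s - hurwitzZeta (0 : UnitAddCircle) s) U :=
    (differentiable_hurwitzZeta_sub_hurwitzZeta _ _).differentiableOn.analyticOnNhd hUo
  have heq := hL.eqOn_of_preconnected_of_eventuallyEq (hdiff.analyticOnNhd hUo)
    hUc.isPreconnected h2U ?_
  · simpa [hurwitzZeta_zero] using heq hsU
  filter_upwards [(isOpen_lt continuous_const Complex.continuous_re).mem_nhds
    (show (1 : ℝ) < (2 : ℂ).re by simp)] with z hz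
  have h1 := hasSum_hurwitzZeta_of_one_lt_re (a := q) ⟨hq0.le, hq1⟩ hz
  have h2 := hasSum_hurwitzZeta_of_one_lt_re (a := 1) (by simp) hz
  rw [show ((1 : ℝ) : UnitAddCircle) = 0 from AddCircle.coe_period 1] at h2
  rw [← (h1.sub h2).tsum_eq]
  refine tsum_congr fun n ↦ ?_
  simp [Complex.cpow_neg]

open HurwitzZeta in
lemma hasSum_hzeta {q s : ℝ} (hq : q ∈ Set.Ioc 0 1) (hs : 1 < s) :
    HasSum (fun n : ℕ ↦ ((n : ℝ) + q) ^ (-s)) (hzeta s q) := by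
  have h := Complex.hasSum_re (hasSum_hurwitzZeta_of_one_lt_re (a := q) (s := s)
    ⟨hq.1.le, hq.2⟩ (by simpa))
  convert! h using 2 with n
  have : 0 ≤ (n : ℝ) + q := by have := hq.1; positivity
  rw [one_div, ← Complex.cpow_neg, ← Complex.ofReal_natCast, ← Complex.ofReal_add,
    ← Complex.ofReal_neg, ← Complex.ofReal_cpow this, Complex.ofReal_re]

open HurwitzZeta Filter Topology in
lemma tendsto_mul_hzeta_add_one (q : ℝ) :
    Tendsto (fun s ↦ s * hzeta (s + 1) q) (𝓝[>] 0) (𝓝 1) := by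
  have hc : Tendsto (fun s : ℝ ↦ ((s + 1 : ℝ) : ℂ)) (𝓝[>] 0) (𝓝[≠] 1) := by
    refine tendsto_nhdsWithin_iff.mpr ⟨?_, ?_⟩
    · have : Continuous fun s : ℝ ↦ ((s + 1 : ℝ) : ℂ) := by fun_prop
      simpa using (this.tendsto 0).mono_left nhdsWithin_le_nhds
    · filter_upwards [self_mem_nhdsWithin] with s hs
      simpa using (show (0 : ℝ) < s from hs).ne'
  have h := (Complex.continuous_re.tendsto _).comp
    ((hurwitzZeta_residue_one (q : UnitAddCircle)).comp hc)
  simp only [Complex.one_re] at h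
  refine h.congr fun s ↦ ?_
  simp [hzeta, Complex.mul_re]

open HurwitzZeta Filter Topology in
lemma hzeta_zero {q : ℝ} (hq : q ∈ Set.Ioc 0 1) : hzeta 0 q = 1 / 2 - q := by
  have hD (s : ℝ) (hs : 0 < s) : hzeta s q - rzeta s ∈
      Set.Icc ((1 - q) * (s * hzeta (s + 1) 1)) ((1 - q) * (s * hzeta (s + 1) q)) := by
    have hpos (n : ℕ) : 0 < (n : ℝ) + q := by have := hq.1; positivity
    have hmem (n : ℕ) := rpow_neg_sub_mem_Icc hs (hpos n) (show (n : ℝ) + q ≤ n + 1 by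
      have := hq.2; linarith)
    simp only [add_sub_add_left_eq_sub] at hmem
    have h1 := ((hasSum_hzeta (q := 1) (by simp) (show 1 < s + 1 by linarith)).mul_left
      (s * (1 - q)))
    have h2 := ((hasSum_hzeta hq (show 1 < s + 1 by linarith)).mul_left (s * (1 - q)))
    have hnonneg (n : ℕ) : 0 ≤ s * (1 - q) * ((n : ℝ) + 1) ^ (-(s + 1)) := by
      have := hq.2
      have : 0 ≤ 1 - q := by linarith
      positivity
    have hsum : Summable fun n : ℕ ↦ ((n : ℝ) + q) ^ (-s) - ((n : ℝ) + 1) ^ (-s) :=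
      .of_nonneg_of_le (fun n ↦ (hnonneg n).trans (hmem n).1) (fun n ↦ (hmem n).2) h2.summable
    have heq : hzeta s q - rzeta s = ∑' n : ℕ, (((n : ℝ) + q) ^ (-s) - ((n : ℝ) + 1) ^ (-s)) := by
      have := congrArg Complex.re (hurwitzZeta_sub_riemannZeta_eq_tsum (s := s) hq (by simpa))
      rw [Complex.sub_re] at this
      rw [hzeta, rzeta, this, ← Complex.ofReal_re (∑' n : ℕ, _), Complex.ofReal_tsum]
      congr 2
      funext n
      rw [Complex.ofReal_sub, Complex.ofReal_cpow (hpos n).le, Complex.ofReal_cpow (by positivity),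
        Complex.ofReal_neg]
    rw [heq]
    constructor
    · refine le_of_eq_of_le (by ring) (hasSum_le (fun n ↦ (hmem n).1) h1 hsum.hasSum)
    · refine (hasSum_le (fun n ↦ (hmem n).2) hsum.hasSum h2).trans_eq (by ring)
  have hlim : Tendsto (fun s ↦ hzeta s q - rzeta s) (𝓝[>] 0) (𝓝 (1 - q)) := by
    have h1 := (tendsto_mul_hzeta_add_one 1).const_mul (1 - q)
    have h2 := (tendsto_mul_hzeta_add_one q).const_mul (1 - q)
    rw [mul_one] at h1 h2
    refine tendsto_of_tendsto_of_tendsto_of_le_of_le' h1 h2 ?_ ?_ <;>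
      filter_upwards [self_mem_nhdsWithin] with s hs
    exacts [(hD s hs).1, (hD s hs).2]
  have hcont : Continuous fun s : ℝ ↦ hzeta s q - rzeta s := by
    have h := (differentiable_hurwitzZeta_sub_hurwitzZeta (q : UnitAddCircle) 0).continuous
    have h' := Complex.continuous_re.comp (h.comp Complex.continuous_ofReal)
    refine h'.congr fun s ↦ ?_
    simp [hzeta, rzeta, hurwitzZeta_zero]
  have h := tendsto_nhds_unique hlim ((hcont.tendsto 0).mono_left nhdsWithin_le_nhds)
  have h0 : rzeta 0 = -1 / 2 := by
    simp [rzeta, riemannZeta_zero]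
  rw [h0] at h
  linarith

lemma hzeta_apply_zero (s : ℝ) : hzeta s 0 = rzeta s := by
  simp [hzeta, rzeta, HurwitzZeta.hurwitzZeta_zero]

lemma hzeta_apply_one (s : ℝ) : hzeta s 1 = rzeta s := by
  rw [← hzeta_apply_zero, hzeta, hzeta, show ((1 : ℝ) : UnitAddCircle) = 0 from
    AddCircle.coe_period 1, AddCircle.coe_zero]

theorem I_reduction_identity (a c : ℝ) (ha : 2 < a) (hc : 2 < c)
    (ha' : ∀ k : ℕ, a ≠ k) (hc' : ∀ k : ℕ, c ≠ k) :
    (1 - a) * Iint (a - 1) c 1 + (1 - c) * Iint a (c - 1) 1 =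
      rzeta (1 - a) * rzeta (1 - c) - ∫ q in (0:ℝ)..1, hzeta (1 - a) q * hzeta (1 - c) q := by
  have hF := continuous_hzeta_one_sub (show 1 < a by linarith)
  have hG := continuous_hzeta_one_sub (show 1 < c by linarith)
  have hF' := continuous_hzeta_one_sub (show 1 < a - 1 by linarith)
  have hG' := continuous_hzeta_one_sub (show 1 < c - 1 by linarith)
  have hweight : Continuous fun q : ℝ ↦ 1 / 2 - q := by fun_prop
  have hIint (u v : ℝ) : Iint u v 1 =
      ∫ q in (0:ℝ)..1, hzeta (1 - u) q * hzeta (1 - v) q * (1 / 2 - q) := by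
    refine intervalIntegral.integral_congr_ae (.of_forall fun q hq ↦ ?_)
    rw [Set.uIoc_of_le zero_le_one] at hq
    simp only [sub_self, hzeta_zero hq]
  have hderiv (q : ℝ) : HasDerivAt (fun q ↦ hzeta (1 - a) q * hzeta (1 - c) q * (1 / 2 - q))
      ((a - 1) * (hzeta (1 - (a - 1)) q * hzeta (1 - c) q * (1 / 2 - q)) +
        (c - 1) * (hzeta (1 - a) q * hzeta (1 - (c - 1)) q * (1 / 2 - q)) -
        hzeta (1 - a) q * hzeta (1 - c) q) q := by
    convert! ((hasDerivAt_hzeta_one_sub ha q).mul (hasDerivAt_hzeta_one_sub hc q)).mul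
      ((hasDerivAt_id q).const_sub (1 / 2)) using 1
    simp only [id, Pi.mul_apply]
    ring
  have h1 : IntervalIntegrable (fun q ↦
      (a - 1) * (hzeta (1 - (a - 1)) q * hzeta (1 - c) q * (1 / 2 - q))) volume 0 1 :=
    (continuous_const.mul ((hF'.mul hG).mul hweight)).intervalIntegrable _ _
  have h2 : IntervalIntegrable (fun q ↦
      (c - 1) * (hzeta (1 - a) q * hzeta (1 - (c - 1)) q * (1 / 2 - q))) volume 0 1 :=
    (continuous_const.mul ((hF.mul hG').mul hweight)).intervalIntegrable _ _
  have h3 : IntervalIntegrable (fun q ↦ hzeta (1 - a) q * hzeta (1 - c) q) volume 0 1 :=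
    (hF.mul hG).intervalIntegrable _ _
  have key := intervalIntegral.integral_eq_sub_of_hasDerivAt (a := 0) (b := 1)
    (fun q _ ↦ hderiv q) ((h1.add h2).sub h3)
  rw [intervalIntegral.integral_sub (h1.add h2) h3, intervalIntegral.integral_add h1 h2,
    intervalIntegral.integral_const_mul, intervalIntegral.integral_const_mul, ← hIint, ← hIint]
    at key
  simp only [hzeta_apply_zero, hzeta_apply_one] at key
  linear_combination -key
end

section
/- Let n ≥ 1 be an integer and let the iterated kernels be K₀(q) := −log sin(πq) and K_j(q) := j ∫₀^q K_{j−1}(t) dt for j ≥ 1. Then for all q ∈ [0,1], K_n(q) = q^n log 2 + n! Σ_{k=1}^{⌊n/2⌋} ((−1)^{k+1} ζ(2k+1) / ((2π)^{2k} (n−2k)!)) q^{n−2k} + (−1)^{⌊n/2⌋} (n!/(2π)^n) Cl_{n+1}(2πq). -/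
open Real MeasureTheory

/-- Clausen functions: `Cl_n` is a sine sum for `n` even, a cosine sum for `n` odd. -/
noncomputable def Cl (n : ℕ) (x : ℝ) : ℝ :=
  if Even n then ∑' k : ℕ+, Real.sin (k * x) / (k : ℝ) ^ n
  else ∑' k : ℕ+, Real.cos (k * x) / (k : ℝ) ^ n

/-- The iterated kernels `K₀(q) = -log sin(πq)`, `K_j(q) = j ∫₀^q K_{j-1}`. -/
noncomputable def Kn : ℕ → ℝ → ℝ
  | 0 => fun q => -Real.log (Real.sin (π * q))
  | (j + 1) => fun q => (j + 1 : ℝ) * ∫ t in (0:ℝ)..q, Kn j t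

open Filter Topology

lemma tsum_pnat_eq_tsum_nat_of_zero (f : ℕ → ℝ) (h : f 0 = 0) :
    ∑' k : ℕ+, f k = ∑' k : ℕ, f k := by
  refine PNat.coe_injective.tsum_eq (f := f) fun k hk => ?_
  have hk0 : k ≠ 0 := fun h0 => hk (h0 ▸ h)
  exact ⟨⟨k, Nat.pos_of_ne_zero hk0⟩, rfl⟩

lemma Cl_of_even {n : ℕ} (h : Even n) (x : ℝ) :
    Cl n x = ∑' k : ℕ, Real.sin (k * x) / (k : ℝ) ^ n := by
  rw [Cl, if_pos h]
  exact tsum_pnat_eq_tsum_nat_of_zero (fun k => Real.sin (k * x) / (k : ℝ) ^ n) (by simp)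

lemma Cl_of_odd {n : ℕ} (h : Odd n) (x : ℝ) :
    Cl n x = ∑' k : ℕ, Real.cos (k * x) / (k : ℝ) ^ n := by
  rw [Cl, if_neg (Nat.not_even_iff_odd.2 h)]
  exact tsum_pnat_eq_tsum_nat_of_zero (fun k => Real.cos (k * x) / (k : ℝ) ^ n)
    (by simp [h.pos.ne'])

lemma rzeta_natCast {n : ℕ} (h : 1 < n) : rzeta n = ∑' k : ℕ, 1 / (k : ℝ) ^ n := by
  have h1 : riemannZeta ((n : ℝ) : ℂ) = ((∑' k : ℕ, 1 / (k : ℝ) ^ n : ℝ) : ℂ) := by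
    rw [Complex.ofReal_natCast, zeta_nat_eq_tsum_of_gt_one h]
    push_cast
    rfl
  rw [rzeta, h1, Complex.ofReal_re]

/-- Termwise integration of a series of continuous functions with a summable uniform bound. -/
lemma integral_tsum_of_norm_le {f : ℕ → ℝ → ℝ} {a : ℕ → ℝ} (hf : ∀ k, Continuous (f k))
    (ha : Summable a) (hb : ∀ k t, ‖f k t‖ ≤ a k) (q : ℝ) :
    ∫ t in (0:ℝ)..q, ∑' k, f k t = ∑' k, ∫ t in (0:ℝ)..q, f k t := by
  refine (intervalIntegral.hasSum_integral_of_dominated_convergence (fun k _ => a k)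
    (fun k => (hf k).aestronglyMeasurable) (fun k => ae_of_all _ fun t _ => hb k t)
    (ae_of_all _ fun t _ => ha) intervalIntegrable_const
    (ae_of_all _ fun t _ => ?_)).tsum_eq.symm
  exact (Summable.of_norm_bounded ha fun k => hb k t).hasSum

lemma integral_cos_nat_mul {k : ℕ} (hk : k ≠ 0) (q : ℝ) :
    ∫ t in (0:ℝ)..q, Real.cos (k * (2 * π * t)) =
      Real.sin (k * (2 * π * q)) / (2 * π * k) := by
  have hc : (2 * π * k : ℝ) ≠ 0 := by positivity
  have := intervalIntegral.integral_comp_mul_left (a := 0) (b := q) Real.cos hc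
  rw [integral_cos] at this
  rw [show (fun t : ℝ => Real.cos (k * (2 * π * t))) = fun t => Real.cos (2 * π * k * t) from
    funext fun t => by ring_nf, this, show (k * (2 * π * q) : ℝ) = 2 * π * k * q by ring]
  simp
  ring

lemma integral_sin_nat_mul {k : ℕ} (hk : k ≠ 0) (q : ℝ) :
    ∫ t in (0:ℝ)..q, Real.sin (k * (2 * π * t)) =
      (1 - Real.cos (k * (2 * π * q))) / (2 * π * k) := by
  have hc : (2 * π * k : ℝ) ≠ 0 := by positivity
  have := intervalIntegral.integral_comp_mul_left (a := 0) (b := q) Real.sin hc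
  rw [integral_sin] at this
  rw [show (fun t : ℝ => Real.sin (k * (2 * π * t))) = fun t => Real.sin (2 * π * k * t) from
    funext fun t => by ring_nf, this, show (k * (2 * π * q) : ℝ) = 2 * π * k * q by ring]
  simp
  ring

lemma integral_tsum_mul_cos {a : ℕ → ℝ} (ha : Summable fun k => ‖a k‖) (h0 : a 0 = 0) (q : ℝ) :
    ∫ t in (0:ℝ)..q, ∑' k : ℕ, a k * Real.cos (k * (2 * π * t)) =
      ∑' k : ℕ, a k * (Real.sin (k * (2 * π * q)) / (2 * π * k)) := by
  rw [integral_tsum_of_norm_le (fun k => by fun_prop) ha]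
  · refine tsum_congr fun k => ?_
    rcases eq_or_ne k 0 with rfl | hk
    · simp [h0]
    · rw [intervalIntegral.integral_const_mul, integral_cos_nat_mul hk]
  · intro k t
    rw [norm_mul]
    exact mul_le_of_le_one_right (norm_nonneg _) (Real.abs_cos_le_one _)

lemma integral_tsum_mul_sin {a : ℕ → ℝ} (ha : Summable fun k => ‖a k‖) (q : ℝ) :
    ∫ t in (0:ℝ)..q, ∑' k : ℕ, a k * Real.sin (k * (2 * π * t)) =
      ∑' k : ℕ, a k * ((1 - Real.cos (k * (2 * π * q))) / (2 * π * k)) := by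
  rw [integral_tsum_of_norm_le (fun k => by fun_prop) ha]
  · refine tsum_congr fun k => ?_
    rcases eq_or_ne k 0 with rfl | hk
    · simp
    · rw [intervalIntegral.integral_const_mul, integral_sin_nat_mul hk]
  · intro k t
    rw [norm_mul]
    exact mul_le_of_le_one_right (norm_nonneg _) (Real.abs_sin_le_one _)

lemma summable_norm_one_div_pow {n : ℕ} (h : 1 < n) :
    Summable fun k : ℕ => ‖1 / (k : ℝ) ^ n‖ :=
  (Real.summable_one_div_nat_pow.2 h).norm

lemma integral_Cl_of_odd {n : ℕ} (h1 : 1 < n) (h : Odd n) (q : ℝ) :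
    ∫ t in (0:ℝ)..q, Cl n (2 * π * t) = Cl (n + 1) (2 * π * q) / (2 * π) := by
  have := integral_tsum_mul_cos (summable_norm_one_div_pow h1) (by simp [h.pos.ne']) q
  simp_rw [Cl_of_odd h, Cl_of_even h.add_one, ← tsum_div_const]
  simp only [one_div_mul_eq_div] at this
  rw [this]
  exact tsum_congr fun k => by ring

lemma integral_Cl_of_even {n : ℕ} (h1 : 1 < n) (h : Even n) (q : ℝ) :
    ∫ t in (0:ℝ)..q, Cl n (2 * π * t) =
      (rzeta (n + 1 : ℕ) - Cl (n + 1) (2 * π * q)) / (2 * π) := by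
  have := integral_tsum_mul_sin (summable_norm_one_div_pow h1) q
  have hs : Summable fun k : ℕ => 1 / (k : ℝ) ^ (n + 1) :=
    Real.summable_one_div_nat_pow.2 (by omega)
  have hs' : Summable fun k : ℕ => Real.cos (k * (2 * π * q)) / (k : ℝ) ^ (n + 1) := by
    refine Summable.of_norm_bounded hs.norm fun k => ?_
    rw [norm_div, norm_div, norm_one]
    gcongr
    exact Real.abs_cos_le_one _
  rw [rzeta_natCast (by omega), Cl_of_odd h.add_one, ← hs.tsum_sub hs', ← tsum_div_const]
  simp_rw [Cl_of_even h]
  simp only [one_div_mul_eq_div] at this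
  rw [this]
  exact tsum_congr fun k => by ring

lemma continuous_Cl {n : ℕ} (h1 : 1 < n) : Continuous (Cl n) := by
  have hb (k : ℕ) (c : ℝ) (hc : |c| ≤ 1) : ‖c / (k : ℝ) ^ n‖ ≤ ‖1 / (k : ℝ) ^ n‖ := by
    rw [norm_div, norm_div, norm_one]
    gcongr
    exact hc
  rcases Nat.even_or_odd n with h | h
  · rw [show Cl n = _ from funext (Cl_of_even h)]
    exact continuous_tsum (fun k => by fun_prop) (summable_norm_one_div_pow h1)
      fun k x => hb k _ (Real.abs_sin_le_one _)
  · rw [show Cl n = _ from funext (Cl_of_odd h)]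
    exact continuous_tsum (fun k => by fun_prop) (summable_norm_one_div_pow h1)
      fun k x => hb k _ (Real.abs_cos_le_one _)

/-- The Poisson-type expansion `-log |1 - r e^{2πit}| = ∑ r^k cos(2πkt) / k`. -/
lemma tsum_pow_div_mul_cos {r : ℝ} (h0 : 0 ≤ r) (h1 : r < 1) (t : ℝ) :
    ∑' k : ℕ, r ^ k / k * Real.cos (k * (2 * π * t)) =
      -(Real.log ((1 - r) ^ 2 + 4 * r * Real.sin (π * t) ^ 2) / 2) := by
  set z : ℂ := r * Complex.exp ((2 * π * t : ℝ) * Complex.I) with hz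
  have hzn : ‖z‖ < 1 := by
    rw [hz, norm_mul, Complex.norm_exp_ofReal_mul_I, mul_one, Complex.norm_real,
      Real.norm_of_nonneg h0]
    exact h1
  have hs := (Complex.hasSum_re (Complex.hasSum_taylorSeries_neg_log hzn)).tsum_eq
  have hn : Complex.normSq (1 - z) = (1 - r) ^ 2 + 4 * r * Real.sin (π * t) ^ 2 := by
    rw [Complex.normSq_apply, hz, Complex.exp_mul_I, ← Complex.ofReal_cos, ← Complex.ofReal_sin]
    simp only [Complex.sub_re, Complex.sub_im, Complex.one_re, Complex.one_im, Complex.re_ofReal_mul,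
      Complex.im_ofReal_mul, Complex.add_re, Complex.add_im, Complex.ofReal_re, Complex.ofReal_im,
      Complex.mul_I_re, Complex.mul_I_im]
    rw [show 2 * π * t = 2 * (π * t) by ring, Real.cos_two_mul, Real.sin_two_mul]
    linear_combination (4 * r * r * Real.cos (π * t) ^ 2 - 4 * r) * Real.sin_sq_add_cos_sq (π * t)
  rw [Complex.neg_re, Complex.log_re, Complex.norm_def, Real.log_sqrt (Complex.normSq_nonneg _),
    hn] at hs
  rw [← hs]
  refine tsum_congr fun k => ?_
  rw [hz, mul_pow, ← Complex.exp_nat_mul, ← Complex.ofReal_pow, mul_div_right_comm,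
    ← Complex.ofReal_natCast k, ← Complex.ofReal_div, Complex.re_ofReal_mul,
    show ((k : ℝ) : ℂ) * ((2 * π * t : ℝ) * Complex.I) = (k * (2 * π * t) : ℝ) * Complex.I by
      push_cast; ring, Complex.exp_ofReal_mul_I_re]

lemma abs_log_one_sub_sq_le {r s : ℝ} (hr : r ∈ Set.Ioo (1 / 4 : ℝ) 1) (h0 : 0 < s)
    (h1 : s ≤ 1) :
    |Real.log ((1 - r) ^ 2 + 4 * r * s ^ 2) / 2| ≤ Real.log 2 + |Real.log s| := by
  obtain ⟨hr0, hr1⟩ := hr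
  have hs2 : s ^ 2 ≤ 1 := by nlinarith
  have hs2' : 0 < s ^ 2 := by positivity
  have hlow : s ^ 2 ≤ (1 - r) ^ 2 + 4 * r * s ^ 2 := by nlinarith [sq_nonneg (1 - r)]
  have hup : (1 - r) ^ 2 + 4 * r * s ^ 2 ≤ 2 ^ 2 := by nlinarith
  have hl := Real.log_le_log hs2' hlow
  have hu := Real.log_le_log (hs2'.trans_le hlow) hup
  rw [Real.log_pow] at hl hu
  push_cast at hl hu
  have hlog2 : 0 < Real.log 2 := Real.log_pos (by norm_num)
  rw [abs_le]
  constructor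
  · linarith [neg_abs_le (Real.log s)]
  · linarith [abs_nonneg (Real.log s)]

lemma intervalIntegrable_log_sin_pi_mul (a b : ℝ) :
    IntervalIntegrable (fun t => Real.log (Real.sin (π * t))) volume a b := by
  have := (intervalIntegrable_log_sin (a := π * a) (b := π * b)).comp_mul_left (c := π)
  simpa [pi_ne_zero] using this

lemma tendsto_tsum_pow_div_mul_sin (q : ℝ) :
    Tendsto (fun r : ℝ => ∑' k : ℕ, r ^ k / k * (Real.sin (k * (2 * π * q)) / (2 * π * k)))
      (𝓝[<] 1) (𝓝 (Cl 2 (2 * π * q) / (2 * π))) := by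
  rw [Cl_of_even even_two, ← tsum_div_const]
  refine tendsto_tsum_of_dominated_convergence (bound := fun k : ℕ => ‖1 / (k : ℝ) ^ 2‖)
    (summable_norm_one_div_pow one_lt_two) (fun k => ?_) ?_
  · have hc : Continuous fun r : ℝ =>
        r ^ k / k * (Real.sin (k * (2 * π * q)) / (2 * π * k)) := by fun_prop
    have := (hc.tendsto 1).mono_left (nhdsWithin_le_nhds (s := Set.Iio 1))
    convert this using 2
    ring
  · filter_upwards [Ioo_mem_nhdsLT (zero_lt_one' ℝ)] with r hr k
    have hpi : 1 ≤ 2 * π := by linarith [Real.pi_gt_three]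
    have h1 : ‖r ^ k‖ ≤ 1 := by
      rw [norm_pow, Real.norm_of_nonneg hr.1.le]
      exact pow_le_one₀ hr.1.le hr.2.le
    have h2 : ‖Real.sin (k * (2 * π * q)) / (2 * π)‖ ≤ 1 := by
      rw [norm_div, Real.norm_of_nonneg (by positivity : 0 ≤ 2 * π)]
      exact div_le_one_of_le₀ ((Real.abs_sin_le_one _).trans hpi) (by positivity)
    rw [show r ^ k / k * (Real.sin (k * (2 * π * q)) / (2 * π * k)) =
      (r ^ k * (Real.sin (k * (2 * π * q)) / (2 * π))) * (1 / (k : ℝ) ^ 2) by ring, norm_mul,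
      norm_mul]
    exact mul_le_of_le_one_left (norm_nonneg _) (mul_le_one₀ h1 (norm_nonneg _) h2)

/-- The classical evaluation of the log-sine integral by `Cl₂`. -/
lemma integral_neg_log_two_sub_log_sin {q : ℝ} (hq : q ∈ Set.Icc (0 : ℝ) 1) :
    ∫ t in (0:ℝ)..q, (-Real.log 2 - Real.log (Real.sin (π * t))) =
      Cl 2 (2 * π * q) / (2 * π) := by
  have hlim : Tendsto (fun r : ℝ => ∫ t in (0:ℝ)..q,
      -(Real.log ((1 - r) ^ 2 + 4 * r * Real.sin (π * t) ^ 2) / 2)) (𝓝[<] 1)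
      (𝓝 (∫ t in (0:ℝ)..q, (-Real.log 2 - Real.log (Real.sin (π * t))))) := by
    have hmem : ∀ᵐ t : ℝ, t ∈ Set.uIoc 0 q → 0 < Real.sin (π * t) := by
      filter_upwards [Measure.ae_ne volume (1 : ℝ)] with t ht1 ht
      rw [Set.uIoc_of_le hq.1] at ht
      have : t < 1 := lt_of_le_of_ne (ht.2.trans hq.2) ht1
      exact Real.sin_pos_of_pos_of_lt_pi (mul_pos Real.pi_pos ht.1) (by nlinarith [Real.pi_pos])
    refine intervalIntegral.tendsto_integral_filter_of_dominated_convergence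
      (fun t => Real.log 2 + |Real.log (Real.sin (π * t))|) (Eventually.of_forall fun r => ?_)
      ?_ (intervalIntegrable_const.add (intervalIntegrable_log_sin_pi_mul 0 q).abs) ?_
    · exact Measurable.aestronglyMeasurable (by fun_prop)
    · filter_upwards [Ioo_mem_nhdsLT (by norm_num : (1 / 4 : ℝ) < 1)] with r hr
      filter_upwards [hmem] with t ht htq
      rw [norm_neg]
      exact abs_log_one_sub_sq_le hr (ht htq) (Real.sin_le_one _)
    · filter_upwards [hmem] with t ht htq
      have hs := ht htq
      have hc : ContinuousAt
          (fun r : ℝ => -(Real.log ((1 - r) ^ 2 + 4 * r * Real.sin (π * t) ^ 2) / 2)) 1 := by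
        refine ((ContinuousAt.log (by fun_prop) ?_).div_const 2).neg
        positivity
      have h := hc.tendsto.mono_left (nhdsWithin_le_nhds (s := Set.Iio 1))
      convert h using 2
      rw [show (1 - 1 : ℝ) ^ 2 + 4 * 1 * Real.sin (π * t) ^ 2 = (2 * Real.sin (π * t)) ^ 2 by ring,
        Real.log_pow, Real.log_mul two_ne_zero hs.ne']
      push_cast
      ring
  refine tendsto_nhds_unique hlim ((tendsto_tsum_pow_div_mul_sin q).congr' ?_)
  filter_upwards [Ioo_mem_nhdsLT (zero_lt_one' ℝ)] with r hr
  rw [← integral_tsum_mul_cos (a := fun k => r ^ k / k) ?_ (by simp)]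
  · simp_rw [tsum_pow_div_mul_cos hr.1.le hr.2]
  · refine Summable.of_norm_bounded (summable_geometric_of_lt_one hr.1.le hr.2) fun k => ?_
    rw [norm_norm, norm_div, norm_pow, Real.norm_of_nonneg hr.1.le]
    rcases eq_or_ne k 0 with rfl | hk
    · simp
    · refine div_le_self (pow_nonneg hr.1.le _) ?_
      rw [Real.norm_natCast]
      exact_mod_cast Nat.one_le_iff_ne_zero.2 hk

lemma Kn_one {q : ℝ} (hq : q ∈ Set.Icc (0 : ℝ) 1) :
    Kn 1 q = q * Real.log 2 + Cl 2 (2 * π * q) / (2 * π) := by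
  have h := integral_neg_log_two_sub_log_sin hq
  rw [intervalIntegral.integral_sub intervalIntegrable_const
    (intervalIntegrable_log_sin_pi_mul 0 q), intervalIntegral.integral_const] at h
  simp only [Kn, intervalIntegral.integral_neg]
  rw [← h]
  simp
  ring

/-- The polynomial part of `Kn n`, without the `log 2` term. -/
noncomputable def zetaPoly (n : ℕ) (q : ℝ) : ℝ :=
  (n.factorial : ℝ) * ∑ k ∈ Finset.Icc 1 (n / 2),
    (-1 : ℝ) ^ (k + 1) * rzeta (2 * k + 1) /
      ((2 * π) ^ (2 * k) * ((n - 2 * k).factorial : ℝ)) * q ^ (n - 2 * k)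

lemma continuous_zetaPoly (n : ℕ) : Continuous (zetaPoly n) := by
  unfold zetaPoly
  fun_prop

lemma integral_zetaPoly (n : ℕ) (q : ℝ) :
    (n + 1 : ℝ) * ∫ t in (0:ℝ)..q, zetaPoly n t =
      ((n + 1).factorial : ℝ) * ∑ k ∈ Finset.Icc 1 (n / 2),
        (-1 : ℝ) ^ (k + 1) * rzeta (2 * k + 1) /
          ((2 * π) ^ (2 * k) * ((n + 1 - 2 * k).factorial : ℝ)) * q ^ (n + 1 - 2 * k) := by
  simp only [zetaPoly]
  rw [intervalIntegral.integral_const_mul, intervalIntegral.integral_finsetSum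
    fun k _ => Continuous.intervalIntegrable (by fun_prop) _ _, ← mul_assoc, Nat.factorial_succ]
  push_cast
  congr 1
  refine Finset.sum_congr rfl fun k hk => ?_
  have hk2 : 2 * k ≤ n := by have := (Finset.mem_Icc.1 hk).2; omega
  rw [intervalIntegral.integral_const_mul, integral_pow, Nat.succ_sub hk2, Nat.factorial_succ,
    zero_pow (by omega), sub_zero]
  push_cast
  field_simp

lemma zetaPoly_succ_of_even {n : ℕ} (h : Even n) (q : ℝ) :
    zetaPoly (n + 1) q = (n + 1 : ℝ) * ∫ t in (0:ℝ)..q, zetaPoly n t := by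
  rw [integral_zetaPoly, zetaPoly, show (n + 1) / 2 = n / 2 by obtain ⟨m, rfl⟩ := h; omega]

lemma zetaPoly_succ_of_odd {n : ℕ} (h : Odd n) (q : ℝ) :
    zetaPoly (n + 1) q = ((n + 1 : ℝ) * ∫ t in (0:ℝ)..q, zetaPoly n t) +
      ((n + 1).factorial : ℝ) * ((-1) ^ (n / 2) * rzeta (n + 1 + 1 : ℕ) / (2 * π) ^ (n + 1)) := by
  obtain ⟨m, rfl⟩ := h
  rw [integral_zetaPoly, zetaPoly, show (2 * m + 1 + 1) / 2 = m + 1 by omega,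
    show (2 * m + 1) / 2 = m by omega, Finset.sum_Icc_succ_top (by omega), mul_add]
  congr 2
  rw [show 2 * m + 1 + 1 - 2 * (m + 1) = 0 by omega,
    show 2 * (m + 1) = 2 * m + 1 + 1 by ring,
    show (2 * ((m + 1 : ℕ) : ℝ) + 1) = ((2 * m + 1 + 1 + 1 : ℕ) : ℝ) by push_cast; ring]
  simp only [Nat.factorial_zero, Nat.cast_one, pow_zero, mul_one]
  ring

lemma Kn_eq_zetaPoly_add_Cl (n : ℕ) (hn : 1 ≤ n) : ∀ q ∈ Set.Icc (0:ℝ) 1,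
    Kn n q = q ^ n * Real.log 2 + zetaPoly n q +
      (-1 : ℝ) ^ (n / 2) * ((n.factorial : ℝ) / (2 * π) ^ n) * Cl (n + 1) (2 * π * q) := by
  induction n, hn using Nat.le_induction with
  | base =>
    intro q hq
    rw [Kn_one hq]
    simp [zetaPoly]
    ring
  | succ n hn ih =>
    intro q hq
    have hstep : Kn (n + 1) q = (n + 1 : ℝ) * ∫ t in (0:ℝ)..q, Kn n t := by simp only [Kn]
    have hcongr : ∫ t in (0:ℝ)..q, Kn n t = ∫ t in (0:ℝ)..q, (t ^ n * Real.log 2 + zetaPoly n t +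
        (-1 : ℝ) ^ (n / 2) * ((n.factorial : ℝ) / (2 * π) ^ n) * Cl (n + 1) (2 * π * t)) := by
      refine intervalIntegral.integral_congr fun t ht => ih t ?_
      rw [Set.uIcc_of_le hq.1] at ht
      exact ⟨ht.1, ht.2.trans hq.2⟩
    have hZ := continuous_zetaPoly n
    have hC : Continuous fun t => Cl (n + 1) (2 * π * t) :=
      (continuous_Cl (by omega)).comp (by fun_prop)
    rw [hstep, hcongr, intervalIntegral.integral_add
      (Continuous.intervalIntegrable (by fun_prop) _ _)
      (Continuous.intervalIntegrable (by fun_prop) _ _), intervalIntegral.integral_add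
      (Continuous.intervalIntegrable (by fun_prop) _ _)
      (Continuous.intervalIntegrable (by fun_prop) _ _), intervalIntegral.integral_mul_const,
      intervalIntegral.integral_const_mul, integral_pow, zero_pow (by omega), sub_zero,
      Nat.factorial_succ]
    rcases Nat.even_or_odd n with h | h
    · rw [zetaPoly_succ_of_even h, integral_Cl_of_odd (by omega) h.add_one,
        show (n + 1) / 2 = n / 2 by obtain ⟨m, rfl⟩ := h; omega]
      push_cast
      field_simp
      ring
    · rw [zetaPoly_succ_of_odd h, integral_Cl_of_even (by omega) h.add_one,
        show (n + 1) / 2 = n / 2 + 1 by obtain ⟨m, rfl⟩ := h; omega, Nat.factorial_succ]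
      push_cast
      field_simp
      ring

theorem Kn_eq_clausen (n : ℕ) (hn : 1 ≤ n) :
    ∀ q ∈ Set.Icc (0:ℝ) 1,
      Kn n q = q ^ n * Real.log 2
        + (n.factorial : ℝ) *
            ∑ k ∈ Finset.Icc 1 (n / 2),
              (-1 : ℝ) ^ (k + 1) * rzeta (2 * k + 1) /
                ((2 * π) ^ (2 * k) * ((n - 2 * k).factorial : ℝ)) * q ^ (n - 2 * k)
        + (-1 : ℝ) ^ (n / 2) * ((n.factorial : ℝ) / (2 * π) ^ n) * Cl (n + 1) (2 * π * q) :=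
  Kn_eq_zetaPoly_add_Cl n hn
end
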